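/- arXiv:1511.01285 — 8 statements merged into one kernel-verified Lean document; each statement's English description precedes it below -/
import Mathlib

section
/- The equation ((11x + 5)y + 3)z = 3x + 1 has no solutions in integers: there do not exist x, y, z ∈ ℤ with ((11x + 5)·y + 3)·z = 3x + 1. -/
/-- The equation `((11x + 5)y + 3)z = 3x + 1` has no solutions in integers. -/
theorem no_integral_points :
    ¬ ∃ x y z : ℤ, ((11 * x + 5) * y + 3) * z = 3 * x + 1 := by
  rintro ⟨x, y, z, h⟩
  have hy : y ≠ 0 := by
    rintro rfl
    omega
  have hle : |(11 * x + 5) * y + 3| ≤ |3 * x + 1| :=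
    Int.le_of_dvd (abs_pos.mpr (by omega)) ((abs_dvd_abs _ _).mpr ⟨z, h.symm⟩)
  have hmul : |11 * x + 5| ≤ |(11 * x + 5) * y| := by
    rw [abs_mul]
    exact le_mul_of_one_le_right (abs_nonneg _) (Int.one_le_abs hy)
  have hx : -1 ≤ x ∧ x ≤ 1 := by
    generalize (11 * x + 5) * y = a at hle hmul
    grind
  obtain ⟨hx₁, hx₂⟩ := hx
  interval_cases x <;> grind
end

section
/- For every prime number p, the equation ((11x + 5)y + 3)z = 3x + 1 has a solution in the p-adic integers: there exist x, y, z ∈ ℤ_p with ((11x + 5)·y + 3)·z = 3x + 1. -/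
/-- For every prime `p`, the equation `((11x + 5)y + 3)z = 3x + 1` has a solution
in the `p`-adic integers. -/
theorem local_solubility (p : ℕ) [Fact p.Prime] :
    ∃ x y z : ℤ_[p], ((11 * x + 5) * y + 3) * z = 3 * x + 1 := by
  -- One of `3` and `8` is a unit, and these are the values of the first factor at
  -- `(x, y) = (0, 0)` and `(x, y) = (0, 1)`.
  have h : IsUnit (3 * 3 : ℤ_[p]) ∨ IsUnit (-8 : ℤ_[p]) :=
    IsLocalRing.isUnit_or_isUnit_of_add_one (by norm_num)
  rcases h with h | h
  · obtain ⟨w, hw⟩ := h.exists_right_inv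
    exact ⟨0, 0, 3 * w, by linear_combination hw⟩
  · obtain ⟨w, hw⟩ := h.exists_right_inv
    exact ⟨0, 1, -w, by linear_combination hw⟩
end

section
/- Every integer solution of the equation (xy − 1)t = x − 1 satisfies t = 0 or |y| ≤ 2 or |x − 1| ≤ 4. That is, for all x, y, t ∈ ℤ with (x·y − 1)·t = x − 1, either t = 0, or |y| ≤ 2, or |x − 1| ≤ 4. -/
/-- Every integer solution of `(xy - 1)t = x - 1` satisfies `t = 0` or `|y| ≤ 2`
or `|x - 1| ≤ 4`. -/
theorem integral_points_bounded (x y t : ℤ) (h : (x * y - 1) * t = x - 1) :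
    t = 0 ∨ |y| ≤ 2 ∨ |x - 1| ≤ 4 := by
  by_contra! hc
  obtain ⟨ht, hy, hx⟩ := hc
  have ht1 : 1 ≤ |t| := Int.one_le_abs ht
  have hle : |x * y - 1| ≤ |x - 1| := by
    rw [← h, abs_mul]
    exact le_mul_of_one_le_right (abs_nonneg _) ht1
  have hxy : |x| * |y| - 1 ≤ |x * y - 1| := by
    simpa [abs_mul] using abs_sub_abs_le_abs_sub (x * y) 1
  have hx1 : |x - 1| ≤ |x| + 1 := by simpa using abs_sub x 1
  have hmul : |x| * 3 ≤ |x| * |y| := mul_le_mul_of_nonneg_left hy (abs_nonneg x)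
  linarith
end

section
/- Let M be a positive integer. Then every M-integral solution (x, y, t) ∈ ℚ³ of the equation (xy − 1)t = x − 1 satisfies t = 0 or |y| ≤ 2M or |x − 1| ≤ 2M + 2. That is, for all x, y, t ∈ ℚ with Mx, My, Mt ∈ ℤ and (x·y − 1)·t = x − 1, either t = 0, or |y| ≤ 2M, or |x − 1| ≤ 2M + 2. -/
/-- For a positive integer `M`, every `M`-integral solution `(x, y, t) ∈ ℚ³` of
`(xy - 1)t = x - 1` satisfies `t = 0` or `|y| ≤ 2M` or `|x - 1| ≤ 2M + 2`. -/
theorem M_integral_points_bounded (M : ℤ) (hM : 0 < M) (x y t : ℚ)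
    (hx : ∃ a : ℤ, (M : ℚ) * x = a) (hy : ∃ b : ℤ, (M : ℚ) * y = b)
    (ht : ∃ c : ℤ, (M : ℚ) * t = c)
    (h : (x * y - 1) * t = x - 1) :
    t = 0 ∨ |y| ≤ 2 * M ∨ |x - 1| ≤ 2 * M + 2 := by
  by_contra! hcon
  obtain ⟨ht0, hy2, hx2⟩ := hcon
  obtain ⟨c, hc⟩ := ht
  have hM1 : (1 : ℚ) ≤ M := by exact_mod_cast hM
  have hMt : 1 ≤ (M : ℚ) * |t| := by
    have hc0 : c ≠ 0 := by
      rintro rfl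
      simp [hM.ne', ht0] at hc
    have hc1 : (1 : ℚ) ≤ |(c : ℚ)| := by exact_mod_cast Int.one_le_abs hc0
    rwa [← hc, abs_mul, abs_of_pos (by positivity : (0 : ℚ) < M)] at hc1
  have hxy : |x * y - 1| ≤ M * |x - 1| := by
    rw [← h, abs_mul]
    nlinarith [abs_nonneg (x * y - 1)]
  have hxy' : |x| * |y| ≤ |x * y - 1| + 1 := by
    simpa [abs_mul] using abs_add_le (x * y - 1) 1
  have hx1 : |x - 1| ≤ |x| + 1 := by simpa using abs_sub x 1
  have hmul : |x| * (2 * M) ≤ |x| * |y| := by gcongr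
  nlinarith
end

section
/- For every positive integer M, the set of M-integral solutions of (xy − 1)t = x − 1 is not Zariski dense in the surface: there exists a polynomial F ∈ ℚ[X, Y, T] which is not divisible by the defining polynomial (XY − 1)T − X + 1, and which vanishes at every (x, y, t) ∈ ℚ³ such that Mx, My, Mt ∈ ℤ and (x·y − 1)·t = x − 1. -/
open MvPolynomial

/-- An `M`-integral solution of `(xy - 1)t = x - 1` off the curves `x = 0` and `x = 1` has
bounded `y`-coordinate. -/
lemma abs_numerator_le_of_mul_sub_one_mul_eq {M a b c : ℤ} (hM : 0 < M) (ha : a ≠ 0)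
    (haM : a ≠ M) (h : (a * b - M ^ 2) * c = M ^ 2 * (a - M)) :
    |b| ≤ 2 * M ^ 2 + M ^ 3 := by
  have hne : M ^ 2 * (a - M) ≠ 0 := mul_ne_zero (by positivity) (sub_ne_zero.mpr haM)
  have hdvd : |a * b - M ^ 2| ≤ M ^ 2 * |a - M| := by
    have := Int.le_of_dvd (abs_pos.mpr hne) ((abs_dvd_abs _ _).mpr (Dvd.intro c h))
    rwa [abs_mul, abs_of_pos (by positivity : 0 < M ^ 2)] at this
  have hsub : |a - M| ≤ |a| + M := (abs_sub a M).trans_eq (by rw [abs_of_pos hM])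
  have hab : |a| * |b| ≤ |a * b - M ^ 2| + M ^ 2 := by
    rw [← abs_mul]
    have := abs_add_le (a * b - M ^ 2) (M ^ 2)
    rwa [sub_add_cancel, abs_of_pos (by positivity : 0 < M ^ 2)] at this
  have ha1 : 1 ≤ |a| := Int.one_le_abs ha
  have hmul : |a| * |b| ≤ |a| * (2 * M ^ 2 + M ^ 3) := by
    have hM2 : 0 < M ^ 2 := by positivity
    have hM3 : 0 < M ^ 3 := by positivity
    nlinarith [mul_le_mul_of_nonneg_left hsub hM2.le,
      mul_le_mul_of_nonneg_right ha1 hM2.le, mul_le_mul_of_nonneg_right ha1 hM3.le]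
  exact le_of_mul_le_mul_left hmul (by lia)

/-- For every positive integer `M`, the set of `M`-integral solutions of
`(xy - 1)t = x - 1` is not Zariski dense in the surface: some polynomial not
divisible by the defining polynomial vanishes at all of them. -/
theorem M_integral_points_not_dense (M : ℤ) (hM : 0 < M) :
    ∃ F : MvPolynomial (Fin 3) ℚ,
      ¬ ((X 0 * X 1 - 1) * X 2 - X 0 + 1 ∣ F) ∧
      ∀ x y t : ℚ, (∃ a : ℤ, (M : ℚ) * x = a) → (∃ b : ℤ, (M : ℚ) * y = b) →
        (∃ c : ℤ, (M : ℚ) * t = c) → (x * y - 1) * t = x - 1 →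
        eval ![x, y, t] F = 0 := by
  set N : ℤ := 2 * M ^ 2 + M ^ 3
  have hNpos : 0 < N := by positivity
  have hMQ : (M : ℚ) ≠ 0 := by exact_mod_cast hM.ne'
  refine ⟨X 0 * (X 0 - 1) * ∏ b ∈ Finset.Icc (-N) N, (C (M : ℚ) * X 1 - C (b : ℚ)), ?_, ?_⟩
  · rintro ⟨G, hG⟩
    have hy : (2 * ((N : ℚ) + 1) - 1) ≠ 0 := by
      have : (0 : ℚ) < N := by exact_mod_cast hNpos
      linarith
    have h := congrArg (eval ![(2 : ℚ), (N : ℚ) + 1, (2 * ((N : ℚ) + 1) - 1)⁻¹]) hG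
    simp only [map_mul, map_sub, map_add, map_one, map_prod, eval_X, eval_C,
      Matrix.cons_val] at h
    rw [mul_inv_cancel₀ hy, show (1 : ℚ) - 2 + 1 = 0 by norm_num, zero_mul] at h
    have hprod := (mul_eq_zero.mp h).resolve_left (by norm_num)
    obtain ⟨b, hb, hb0⟩ := Finset.prod_eq_zero_iff.mp hprod
    have hbN := (Finset.mem_Icc.mp hb).2
    have hbM : M * (N + 1) = b := by exact_mod_cast sub_eq_zero.mp hb0
    nlinarith
  · rintro x y t ⟨a, ha⟩ ⟨b, hb⟩ ⟨c, hc⟩ h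
    simp only [map_mul, map_sub, map_one, map_prod, eval_X, eval_C, Matrix.cons_val]
    by_cases hx0 : x = 0
    · simp [hx0]
    by_cases hx1 : x = 1
    · simp [hx1]
    have ha0 : a ≠ 0 := by
      rintro rfl
      simp [hMQ, hx0] at ha
    have haM : a ≠ M := by
      rintro rfl
      exact hx1 (mul_left_cancel₀ hMQ (ha.trans (mul_one _).symm))
    have habc : (a * b - M ^ 2) * c = M ^ 2 * (a - M) := by
      have : ((a : ℚ) * b - M ^ 2) * c = M ^ 2 * (a - M) := by
        rw [← ha, ← hb, ← hc]
        linear_combination (M : ℚ) ^ 3 * h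
      exact_mod_cast this
    have hbN := abs_le.mp (abs_numerator_le_of_mul_sub_one_mul_eq hM ha0 haM habc)
    exact mul_eq_zero_of_right _
      (Finset.prod_eq_zero (Finset.mem_Icc.mpr hbN) (sub_eq_zero.mpr hb))
end

section
/- The set of integer solutions of (xy − 1)t = x − 1 is not Zariski dense in the surface: there exists a polynomial F ∈ ℚ[X, Y, T] which is not divisible by the defining polynomial (XY − 1)T − X + 1, and which vanishes at every (x, y, t) ∈ ℤ³ with (x·y − 1)·t = x − 1. -/
open MvPolynomial

/-- An integral point of `(xy - 1)t = x - 1` has `|x| ≤ 1` or `|y| ≤ 2`. -/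
theorem abs_le_one_or_abs_le_two {x y t : ℤ} (h : (x * y - 1) * t = x - 1) :
    |x| ≤ 1 ∨ |y| ≤ 2 := by
  by_contra! hxy
  obtain ⟨hx, hy⟩ := hxy
  have hx1 : x - 1 ≠ 0 := by
    rintro h1
    obtain rfl : x = 1 := by omega
    norm_num at hx
  have hle : |x * y - 1| ≤ |x - 1| :=
    Int.le_of_dvd (abs_pos.mpr hx1) ((abs_dvd_abs _ _).mpr ⟨t, h.symm⟩)
  have hlower : |x * y| - |1| ≤ |x * y - 1| := abs_sub_abs_le_abs_sub _ _
  have hupper : |x - 1| ≤ |x| + |1| := abs_sub _ _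
  rw [abs_mul, abs_one] at hlower
  rw [abs_one] at hupper
  nlinarith

/-- The set of integer solutions of `(xy - 1)t = x - 1` is not Zariski dense in
the surface: some polynomial not divisible by the defining polynomial vanishes
at all of them. -/
theorem integral_points_not_dense :
    ∃ F : MvPolynomial (Fin 3) ℚ,
      ¬ ((X 0 * X 1 - 1) * X 2 - X 0 + 1 ∣ F) ∧
      ∀ x y t : ℤ, (x * y - 1) * t = x - 1 →
        eval ![(x : ℚ), (y : ℚ), (t : ℚ)] F = 0 := by
  refine ⟨X 0 * (X 0 ^ 2 - 1) * (X 1 * (X 1 ^ 2 - 1) * (X 1 ^ 2 - C 4)), ?_, ?_⟩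
  · rintro ⟨G, hG⟩
    have hpoint := congrArg (eval ![(2 : ℚ), 3, 1 / 5]) hG
    simp only [map_mul, map_sub, map_add, map_pow, map_one, eval_X, eval_C, Matrix.cons_val] at hpoint
    norm_num at hpoint
  · intro x y t h
    rcases abs_le_one_or_abs_le_two h with hx | hy
    · obtain ⟨h1, h2⟩ := abs_le.mp hx
      interval_cases x <;> simp
    · obtain ⟨h1, h2⟩ := abs_le.mp hy
      interval_cases y <;> norm_num
end

section
/- Let a be a positive integer which is not a perfect square, let p be an odd prime with p ∤ a, and let π be an element of the ring ℤ[√a] whose norm satisfies N(π) = p or N(π) = −p. Suppose that the natural map on unit groups (ℤ[√a])ˣ → (ℤ[√a]/(π))ˣ, induced by reduction modulo the principal ideal (π), is surjective. Then the set of triples (x, y, t) ∈ ℤ³ satisfying both (x² − a·y²)·t = y − 1 and x² − a·y² = ±p (i.e. x² − a·y² = p or x² − a·y² = −p) is infinite. -/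
/-- For non-square `a > 0` and `m ≠ 0` there is a positive solution of the Pell equation of `a`
congruent to `1` modulo `m`. -/
theorem Pell.exists_pos_solution_modEq_one {a m : ℤ} (ha : 0 < a) (hsq : ¬ IsSquare a)
    (hm : m ≠ 0) :
    ∃ δ : Pell.Solution₁ a, 0 < δ.x ∧ 0 < δ.y ∧ m ∣ δ.x - 1 ∧ m ∣ δ.y := by
  have hsq' : ¬ IsSquare (a * |m| ^ 2) := by
    rintro ⟨r, hr⟩
    obtain ⟨s, rfl⟩ : |m| ∣ r := (Int.pow_dvd_pow_iff two_ne_zero).1 ⟨a, by linarith⟩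
    have hm2 : |m| ^ 2 ≠ 0 := pow_ne_zero _ (abs_ne_zero.2 hm)
    exact hsq ⟨s, mul_right_cancel₀ hm2 (by linear_combination hr)⟩
  have hm0 : 0 < |m| := abs_pos.2 hm
  obtain ⟨ε, hx, hy⟩ := Pell.Solution₁.exists_pos_of_not_isSquare (by positivity) hsq'
  have hε := ε.prop
  refine ⟨Pell.Solution₁.mk (ε.x ^ 2 + a * |m| ^ 2 * ε.y ^ 2) (2 * |m| * ε.x * ε.y) ?_,
    ?_, ?_, ?_, ?_⟩
  · linear_combination (ε.x ^ 2 - a * |m| ^ 2 * ε.y ^ 2 + 1) * hε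
  · have : 0 < ε.x := by linarith
    simp only [Pell.Solution₁.x_mk]
    positivity
  · have : 0 < ε.x := by linarith
    simp only [Pell.Solution₁.y_mk]
    positivity
  · simp only [Pell.Solution₁.x_mk]
    exact ⟨2 * a * m * ε.y ^ 2, by
      linear_combination hε + 2 * a * ε.y ^ 2 * sq_abs m⟩
  · simp only [Pell.Solution₁.y_mk]
    exact (self_dvd_abs m).trans ⟨2 * ε.x * ε.y, by ring⟩

/-- The powers of a positive solution of the Pell equation have strictly increasing `y`. -/
theorem Pell.Solution₁.strictMono_y_pow {a : ℤ} {δ : Pell.Solution₁ a}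
    (hx : 0 < δ.x) (hy : 0 < δ.y) : StrictMono fun n : ℕ => (δ ^ n).y := by
  refine strictMono_nat_of_lt_succ fun n => ?_
  have hxn := Pell.Solution₁.x_pow_pos hx n
  have hyn : 0 ≤ (δ ^ n).y := by
    cases n with
    | zero => simp
    | succ n => exact (Pell.Solution₁.y_pow_succ_pos hx hy n).le
  rw [pow_succ, Pell.Solution₁.y_mul]
  nlinarith [mul_pos hxn hy]

/-- Multiplying by powers of a Pell solution congruent to `1` modulo `m` preserves the residue of
the imaginary part modulo `m`. -/
theorem Zsqrtd.dvd_im_mul_pow_sub_one {a m : ℤ} {δ : Pell.Solution₁ a}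
    (hx : m ∣ δ.x - 1) (hy : m ∣ δ.y) {z : ℤ√a} (hz : m ∣ z.im - 1) (n : ℕ) :
    m ∣ (z * (δ : ℤ√a) ^ n).im - 1 := by
  induction n with
  | zero => simpa using hz
  | succ n ih =>
    rw [pow_succ, ← mul_assoc, Zsqrtd.im_mul]
    change m ∣ (z * (δ : ℤ√a) ^ n).re * δ.y + (z * (δ : ℤ√a) ^ n).im * δ.x - 1
    generalize z * (δ : ℤ√a) ^ n = w at ih ⊢
    rw [show w.re * δ.y + w.im * δ.x - 1 = w.re * δ.y + w.im * (δ.x - 1) + (w.im - 1) by ring]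
    exact ((hy.mul_left w.re).add (hx.mul_left w.im)).add ih

/-- The imaginary part of an element of norm `±p` is prime to `p`. -/
theorem Zsqrtd.not_dvd_im_of_natAbs_norm_eq_prime {a : ℤ} {p : ℕ} (hp : p.Prime) {z : ℤ√a}
    (hz : z.norm.natAbs = p) : ¬ (p : ℤ) ∣ z.im := by
  intro him
  have hpZ : Prime (p : ℤ) := Nat.prime_iff_prime_int.1 hp
  have hnorm : (p : ℤ) ∣ z.norm := Int.natCast_dvd.2 (by rw [hz])
  have hre : (p : ℤ) ∣ z.re := by
    refine hpZ.dvd_of_dvd_pow (n := 2) ?_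
    have h := hnorm.add (him.mul_left (a * z.im))
    rw [Zsqrtd.norm_def] at h
    convert h using 1
    ring
  have hsq : (p : ℤ) * p ∣ z.norm := by
    rw [Zsqrtd.norm_def, mul_assoc]
    exact (mul_dvd_mul hre hre).sub ((mul_dvd_mul him him).mul_left a)
  rw [← Int.natCast_mul, Int.natCast_dvd, hz] at hsq
  have := Nat.le_of_dvd hp.pos hsq
  nlinarith [hp.two_le]

/-- If the units of `ℤ[√a]` surject onto those of `ℤ[√a]/(π)`, where `π` has norm `±p`, then some
associate of the conjugate of `π` has imaginary part congruent to `1` modulo `p`. -/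
theorem Zsqrtd.exists_norm_mul_unit_im_modEq_one {a : ℤ} {p : ℕ} (hp : p.Prime) {π : ℤ√a}
    (hπ : π.norm.natAbs = p)
    (hsurj : Function.Surjective
      (Units.map (Ideal.Quotient.mk (Ideal.span {π})).toMonoidHom)) :
    ∃ u : (ℤ√a)ˣ, (p : ℤ) ∣ (star π * u).im - 1 := by
  obtain ⟨c, d, hcd⟩ : IsCoprime π.im (π.norm) := by
    rw [Int.isCoprime_iff_nat_coprime, hπ, Nat.coprime_comm, hp.coprime_iff_not_dvd,
      ← Int.natCast_dvd]
    exact not_dvd_im_of_natAbs_norm_eq_prime hp hπ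
  have hnorm : Ideal.Quotient.mk (Ideal.span {π}) (π.norm : ℤ√a) = 0 := by
    rw [Ideal.Quotient.eq_zero_iff_dvd, Zsqrtd.norm_eq_mul_conj]
    exact dvd_mul_right _ _
  have hunit : Ideal.Quotient.mk (Ideal.span {π}) (-(c : ℤ√a)) *
      Ideal.Quotient.mk (Ideal.span {π}) (-(π.im : ℤ√a)) = 1 := by
    rw [← map_mul, neg_mul_neg]
    have h := congrArg (fun n : ℤ => Ideal.Quotient.mk (Ideal.span {π}) (n : ℤ√a)) hcd
    simpa only [Int.cast_add, Int.cast_mul, map_add, map_mul, hnorm, mul_zero, add_zero,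
      Int.cast_one, map_one] using h
  obtain ⟨u, hu⟩ := hsurj (Units.mkOfMulEqOne _ _ hunit)
  have hu' : Ideal.Quotient.mk (Ideal.span {π}) (u : ℤ√a) =
      Ideal.Quotient.mk (Ideal.span {π}) (-(c : ℤ√a)) := congrArg Units.val hu
  rw [Ideal.Quotient.eq, Ideal.mem_span_singleton] at hu'
  obtain ⟨v, hv⟩ := hu'
  refine ⟨u, ?_⟩
  have hmul : star π * (u : ℤ√a) = (π.norm : ℤ√a) * v - (c : ℤ√a) * star π := by
    rw [Zsqrtd.norm_eq_mul_conj]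
    linear_combination star π * hv
  have him : (star π * (u : ℤ√a)).im - 1 = π.norm * (v.im - d) := by
    rw [hmul]
    simp only [Zsqrtd.im_sub, Zsqrtd.im_smul, Zsqrtd.im_star]
    linear_combination hcd
  rw [him]
  exact Dvd.dvd.mul_right (Int.natCast_dvd.2 (by rw [hπ])) _


/-- Let `a` be a positive non-square integer, `p` an odd prime not dividing `a`,
and `π ∈ ℤ[√a]` an element of norm `±p`. If the reduction map
`(ℤ[√a])ˣ → (ℤ[√a]/(π))ˣ` is surjective, then the surface `(x² - ay²)t = y - 1`
contains infinitely many integral points with `x² - ay² = ±p`. -/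
theorem infinitely_many_points_on_Cp
    (a : ℤ) (ha : 0 < a) (hsq : ¬ IsSquare a)
    (p : ℕ) (hp : p.Prime) (hodd : p ≠ 2) (hpa : ¬ ((p : ℤ) ∣ a))
    (π : ℤ√a) (hπ : π.norm = (p : ℤ) ∨ π.norm = -(p : ℤ))
    (hsurj : Function.Surjective
      (Units.map (Ideal.Quotient.mk (Ideal.span {π})).toMonoidHom)) :
    {v : ℤ × ℤ × ℤ |
      (v.1 ^ 2 - a * v.2.1 ^ 2) * v.2.2 = v.2.1 - 1 ∧
      (v.1 ^ 2 - a * v.2.1 ^ 2 = (p : ℤ) ∨ v.1 ^ 2 - a * v.2.1 ^ 2 = -(p : ℤ))}.Infinite := by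
  have hnat {n : ℤ} : n.natAbs = p ↔ n = (p : ℤ) ∨ n = -(p : ℤ) := by omega
  have hp0 : (p : ℤ) ≠ 0 := by exact_mod_cast hp.ne_zero
  obtain ⟨u, hu⟩ := Zsqrtd.exists_norm_mul_unit_im_modEq_one hp (hnat.2 hπ) hsurj
  obtain ⟨δ, hx, hy, hx1, hy0⟩ := Pell.exists_pos_solution_modEq_one ha hsq hp0
  have hδ : (δ : ℤ√a).norm.natAbs = 1 := by
    rw [Zsqrtd.norm_eq_one_iff_mem_unitary.2 δ.2]
    rfl
  set z : ℕ → ℤ√a := fun n => star π * u * (δ : ℤ√a) ^ n with hz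
  have hznorm (n : ℕ) : (z n).norm.natAbs = p := by
    have hu1 := Zsqrtd.norm_eq_one_iff.2 u.isUnit
    have hδn : ((δ : ℤ√a) ^ n).norm.natAbs = 1 :=
      Zsqrtd.norm_eq_one_iff.2 ((Zsqrtd.norm_eq_one_iff.1 hδ).pow n)
    simp only [hz, Zsqrtd.norm_mul, Int.natAbs_mul, Zsqrtd.norm_conj, hu1, hδn, mul_one]
    exact hnat.2 hπ
  have hzim (n : ℕ) : (z n).norm ∣ (z n).im - 1 := by
    rw [← Int.natAbs_dvd, hznorm n]
    exact Zsqrtd.dvd_im_mul_pow_sub_one hx1 hy0 hu n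
  have hzinj : Function.Injective z := by
    intro i j hij
    have hstar : π * star π = (π.norm : ℤ√a) := (Zsqrtd.norm_eq_mul_conj π).symm
    have hπ0 : π.norm ≠ 0 := by omega
    have hpow : (δ : ℤ√a) ^ i = (δ : ℤ√a) ^ j := by
      refine Zsqrtd.eq_of_smul_eq_smul_left hπ0 ?_
      rw [← u.isUnit.mul_right_inj, ← hstar]
      simp only [hz] at hij
      linear_combination π * hij
    refine (Pell.Solution₁.strictMono_y_pow hx hy).injective ?_
    exact congrArg Pell.Solution₁.y (Subtype.ext (hpow))
  choose t ht using hzim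
  refine Set.infinite_of_injective_forall_mem
    (f := fun n : ℕ => ((z n).re, (z n).im, t n)) ?_ fun n => ?_
  · intro i j hij
    simp only [Prod.mk.injEq] at hij
    exact hzinj (Zsqrtd.ext hij.1 hij.2.1)
  · have hn : (z n).re ^ 2 - a * (z n).im ^ 2 = (z n).norm := by
      rw [Zsqrtd.norm_def]
      ring
    simp only [Set.mem_ofPred_eq, hn]
    exact ⟨(ht n).symm, hnat.1 (hznorm n)⟩
end

section
/- Let a be a positive integer which is not a perfect square. Suppose that there are infinitely many primes p for which the set of triples (x, y, t) ∈ ℤ³ satisfying both (x² − a·y²)·t = y − 1 and x² − a·y² = ±p is infinite. Then the integer points of the surface (x² − ay²)t = y − 1 are Zariski dense: every polynomial F ∈ ℚ[X, Y, T] which vanishes at every (x, y, t) ∈ ℤ³ with (x² − a·y²)·t = y − 1 is divisible by the defining polynomial (X² − aY²)T − Y + 1. -/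
open MvPolynomial

/-- Substitution of `s` for the outer and of `t` for the inner variable of a bivariate
polynomial over `ℚ`. -/
noncomputable def bivariateSubst {R : Type*} [CommRing R] [Algebra ℚ R] (s t : R) :
    Polynomial (Polynomial ℚ) →+* R :=
  Polynomial.eval₂RingHom (Polynomial.aeval t : Polynomial ℚ →ₐ[ℚ] R).toRingHom s

@[simp]
lemma bivariateSubst_X {R : Type*} [CommRing R] [Algebra ℚ R] (s t : R) :
    bivariateSubst s t Polynomial.X = s := by
  simp [bivariateSubst]

@[simp]
lemma bivariateSubst_C {R : Type*} [CommRing R] [Algebra ℚ R] (s t : R) (q : Polynomial ℚ) :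
    bivariateSubst s t (Polynomial.C q) = Polynomial.aeval t q := by
  simp [bivariateSubst]

lemma map_bivariateSubst {R S : Type*} [CommRing R] [Algebra ℚ R] [CommRing S] [Algebra ℚ S]
    (f : R →+* S) (s t : R) (P : Polynomial (Polynomial ℚ)) :
    f (bivariateSubst s t P) = bivariateSubst (f s) (f t) P := by
  have : f.comp (bivariateSubst s t) = bivariateSubst (f s) (f t) := by
    ext <;> simp
  exact DFunLike.congr_fun this P

lemma bivariateSubst_eq_evalEval (s t : ℚ) (P : Polynomial (Polynomial ℚ)) :
    bivariateSubst s t P = P.evalEval t s := by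
  have : bivariateSubst s t = Polynomial.evalEvalRingHom t s := by
    ext <;> simp
  exact DFunLike.congr_fun this P

/-- A bivariate polynomial vanishing at infinitely many points of infinitely many lines
`s = c` is zero. -/
lemma eq_zero_of_infinite_bivariateSubst_eq_zero (P : Polynomial (Polynomial ℚ))
    (h : {c : ℚ | {t : ℚ | bivariateSubst c t P = 0}.Infinite}.Infinite) : P = 0 := by
  apply Polynomial.eq_zero_of_infinite_isRoot
  refine (h.image (Polynomial.C_injective.injOn)).mono ?_
  rintro _ ⟨c, hc, rfl⟩
  apply Polynomial.eq_zero_of_infinite_isRoot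
  refine Set.Infinite.mono (fun t ht ↦ ?_) hc
  simpa [bivariateSubst_eq_evalEval, Polynomial.evalEval] using ht

/-- The polynomial `s + a (1 + s t)²`, equal to `x²` on the surface `(x² - a y²) t = y - 1`
when `s = x² - a y²`. -/
noncomputable def surfaceQuadratic (a : ℤ) : Polynomial (Polynomial ℚ) :=
  Polynomial.X + (a : Polynomial (Polynomial ℚ)) *
    (1 + Polynomial.X * Polynomial.C Polynomial.X) ^ 2

lemma leadingCoeff_surfaceQuadratic {a : ℤ} (ha : a ≠ 0) :
    (surfaceQuadratic a).leadingCoeff = Polynomial.C (a : ℚ) * Polynomial.X ^ 2 := by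
  have h : surfaceQuadratic a =
      Polynomial.C (Polynomial.C (a : ℚ) * Polynomial.X ^ 2) * Polynomial.X ^ 2 +
        Polynomial.C (2 * Polynomial.C (a : ℚ) * Polynomial.X + 1) * Polynomial.X +
          Polynomial.C (Polynomial.C (a : ℚ)) := by
    simp only [surfaceQuadratic, map_add, map_mul, map_pow, map_one, map_ofNat, map_intCast]
    ring
  rw [h, Polynomial.leadingCoeff_quadratic]
  simp [ha]

/-- The polynomial `surfaceQuadratic a` is not a square in the field of fractions. -/
lemma eq_zero_of_sq_eq_surfaceQuadratic_mul_sq {a : ℤ} (hsq : ¬ IsSquare a)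
    {A B : Polynomial (Polynomial ℚ)} (h : A ^ 2 = surfaceQuadratic a * B ^ 2) :
    A = 0 ∧ B = 0 := by
  have ha : a ≠ 0 := by
    rintro rfl
    exact hsq IsSquare.zero
  have hB : B = 0 := by
    by_contra hB
    apply hsq
    have h' := congrArg (fun P ↦ P.leadingCoeff.leadingCoeff) h
    simp only [Polynomial.leadingCoeff_pow, Polynomial.leadingCoeff_mul,
      leadingCoeff_surfaceQuadratic ha, Polynomial.leadingCoeff_C, Polynomial.leadingCoeff_X,
      one_pow, mul_one] at h'
    have hb : B.leadingCoeff.leadingCoeff ≠ 0 := by simpa using hB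
    rw [← Rat.isSquare_intCast_iff]
    refine ⟨A.leadingCoeff.leadingCoeff / B.leadingCoeff.leadingCoeff, ?_⟩
    field_simp
    exact h'.symm
  subst hB
  simpa using h

/-- Modulo the equation of the surface `(x² - a y²) t = y - 1`, every polynomial is of the form
`A(s, t) + x B(s, t)` with `s = x² - a y²`. -/
lemma exists_surface_normal_form (a : ℤ) (F : MvPolynomial (Fin 3) ℚ) :
    ∃ A B : Polynomial (Polynomial ℚ),
      (X 0 ^ 2 - C (a : ℚ) * X 1 ^ 2) * X 2 - X 1 + 1 ∣
        F - (bivariateSubst (X 0 ^ 2 - C (a : ℚ) * X 1 ^ 2) (X 2) A +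
          X 0 * bivariateSubst (X 0 ^ 2 - C (a : ℚ) * X 1 ^ 2) (X 2) B) := by
  induction F using MvPolynomial.induction_on with
  | C q => exact ⟨Polynomial.C (Polynomial.C q), 0, by simp [MvPolynomial.algebraMap_eq]⟩
  | add F G hF hG =>
    obtain ⟨A, B, u, hu⟩ := hF
    obtain ⟨A', B', v, hv⟩ := hG
    refine ⟨A + A', B + B', u + v, ?_⟩
    simp only [map_add]
    linear_combination hu + hv
  | mul_X F i hF =>
    obtain ⟨A, B, u, hu⟩ := hF
    fin_cases i
    · refine ⟨surfaceQuadratic a * B, A, ?_⟩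
      set s : MvPolynomial (Fin 3) ℚ := X 0 ^ 2 - C (a : ℚ) * X 1 ^ 2 with hs
      refine ⟨u * X 0 - C (a : ℚ) * (1 + s * X 2 + X 1) * bivariateSubst s (X 2) B, ?_⟩
      simp only [surfaceQuadratic, map_add, map_mul, map_pow, map_one, map_intCast,
        bivariateSubst_X, bivariateSubst_C, Polynomial.aeval_X, Fin.zero_eta, Fin.isValue] at hu hs ⊢
      linear_combination X 0 * hu - bivariateSubst s (X 2) B * hs
    · refine ⟨(1 + Polynomial.X * Polynomial.C Polynomial.X) * A,
        (1 + Polynomial.X * Polynomial.C Polynomial.X) * B, ?_⟩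
      set s : MvPolynomial (Fin 3) ℚ := X 0 ^ 2 - C (a : ℚ) * X 1 ^ 2
      refine ⟨u * X 1 - (bivariateSubst s (X 2) A + X 0 * bivariateSubst s (X 2) B), ?_⟩
      simp only [map_add, map_mul, map_one, bivariateSubst_X, bivariateSubst_C,
        Polynomial.aeval_X, Fin.mk_one, Fin.isValue]
      linear_combination X 1 * hu
    · refine ⟨Polynomial.C Polynomial.X * A, Polynomial.C Polynomial.X * B, u * X 2, ?_⟩
      simp only [map_mul, bivariateSubst_C, Polynomial.aeval_X, Fin.reduceFinMk, Fin.isValue]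
      linear_combination X 2 * hu

/-- The integral points of the surface `(x² - a y²) t = y - 1` on the curve `x² - a y² = c`. -/
def surfaceLevelSet (a c : ℤ) : Set (ℤ × ℤ × ℤ) :=
  {v | (v.1 ^ 2 - a * v.2.1 ^ 2) * v.2.2 = v.2.1 - 1 ∧ v.1 ^ 2 - a * v.2.1 ^ 2 = c}

lemma infinite_image_surfaceLevelSet {a c : ℤ} (h : (surfaceLevelSet a c).Infinite) :
    ((fun v : ℤ × ℤ × ℤ ↦ v.2.2) '' surfaceLevelSet a c).Infinite := by
  intro hfin
  refine h (Set.Finite.of_finite_fibers _ hfin fun t _ ↦ ?_)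
  set d := c + a * (1 + c * t) ^ 2
  refine ((Set.finite_Icc (-d) d).prod
    ((Set.finite_singleton (1 + c * t)).prod (Set.finite_singleton t))).subset ?_
  rintro ⟨x, y, t'⟩ ⟨⟨h₁, h₂⟩, h₃⟩
  obtain rfl : t' = t := h₃
  simp only at h₁ h₂
  rw [h₂] at h₁
  obtain rfl : y = 1 + c * t' := by linarith
  have hx : x ^ 2 = d := by linarith
  simp only [Set.mem_prod, Set.mem_Icc, Set.mem_singleton_iff, and_true]
  constructor <;> nlinarith [Int.le_self_sq x, Int.le_self_sq (-x)]

/-- If infinitely many primes `p` have infinitely many integral points with `x² - a y² = ±p`,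
then infinitely many of the curves `x² - a y² = c` have infinitely many integral points. -/
lemma infinite_setOf_infinite_surfaceLevelSet {a : ℤ}
    (h : {p : ℕ | p.Prime ∧
      {v : ℤ × ℤ × ℤ |
        (v.1 ^ 2 - a * v.2.1 ^ 2) * v.2.2 = v.2.1 - 1 ∧
        (v.1 ^ 2 - a * v.2.1 ^ 2 = (p : ℤ) ∨
          v.1 ^ 2 - a * v.2.1 ^ 2 = -(p : ℤ))}.Infinite}.Infinite) :
    {c : ℤ | (surfaceLevelSet a c).Infinite}.Infinite := by
  refine Set.Infinite.of_image Int.natAbs (h.mono ?_)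
  rintro p ⟨-, hp⟩
  simp only [and_or_left, Set.ofPred_or, Set.infinite_union] at hp
  rcases hp with hp | hp
  · exact ⟨p, hp, by simp⟩
  · exact ⟨-p, hp, by simp⟩

/-- Let `a` be a positive non-square integer. If there are infinitely many primes
`p` such that the surface `(x² - ay²)t = y - 1` contains infinitely many integral
points with `x² - ay² = ±p`, then the integral points of the surface are Zariski
dense: every polynomial vanishing on all of them is divisible by the defining
polynomial. -/
theorem integral_points_dense_of_infinitely_many_Cp
    (a : ℤ) (ha : 0 < a) (hsq : ¬ IsSquare a)
    (h : {p : ℕ | p.Prime ∧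
      {v : ℤ × ℤ × ℤ |
        (v.1 ^ 2 - a * v.2.1 ^ 2) * v.2.2 = v.2.1 - 1 ∧
        (v.1 ^ 2 - a * v.2.1 ^ 2 = (p : ℤ) ∨
          v.1 ^ 2 - a * v.2.1 ^ 2 = -(p : ℤ))}.Infinite}.Infinite)
    (F : MvPolynomial (Fin 3) ℚ)
    (hF : ∀ x y t : ℤ, (x ^ 2 - a * y ^ 2) * t = y - 1 →
      eval ![(x : ℚ), (y : ℚ), (t : ℚ)] F = 0) :
    (X 0 ^ 2 - C (a : ℚ) * X 1 ^ 2) * X 2 - X 1 + 1 ∣ F := by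
  obtain ⟨A, B, hAB⟩ := exists_surface_normal_form a F
  have hvanish : A ^ 2 - surfaceQuadratic a * B ^ 2 = 0 := by
    apply eq_zero_of_infinite_bivariateSubst_eq_zero
    refine ((infinite_setOf_infinite_surfaceLevelSet h).image
      (Int.cast_injective (α := ℚ)).injOn).mono ?_
    rintro _ ⟨c, hc, rfl⟩
    refine ((infinite_image_surfaceLevelSet hc).image
      (Int.cast_injective (α := ℚ)).injOn).mono ?_
    rintro _ ⟨_, ⟨⟨x, y, t⟩, ⟨h₁, h₂⟩, rfl⟩, rfl⟩
    simp only at h₁ h₂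
    have hs : (x : ℚ) ^ 2 - a * y ^ 2 = c := by exact_mod_cast h₂
    have hy : (c : ℚ) * t = y - 1 := by
      rw [← h₂]
      exact_mod_cast h₁
    have hD := map_dvd (eval ![(x : ℚ), (y : ℚ), (t : ℚ)]) hAB
    simp only [map_intCast, map_add, map_sub, map_mul, map_pow, eval_X, Matrix.cons_val_zero,
      Matrix.cons_val_one, Matrix.cons_val, map_one, map_bivariateSubst, hF x y t h₁, hs, hy,
      sub_sub_cancel_left, neg_add_cancel, zero_sub, neg_add_rev, zero_dvd_iff] at hD
    simp only [Set.mem_ofPred_eq, surfaceQuadratic, map_sub, map_add, map_mul, map_pow, map_one,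
      map_intCast, bivariateSubst_X, bivariateSubst_C, Polynomial.aeval_X, hy]
    set α := bivariateSubst (c : ℚ) (t : ℚ) A
    set β := bivariateSubst (c : ℚ) (t : ℚ) B
    linear_combination (-α + x * β) * hD + β ^ 2 * hs
  obtain ⟨rfl, rfl⟩ := eq_zero_of_sq_eq_surfaceQuadratic_mul_sq hsq (sub_eq_zero.mp hvanish)
  simpa using hAB
end
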